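/- arXiv:math/9412214 — 4 statements merged into one kernel-verified Lean document; each statement's English description precedes it below -/
import Mathlib

section
/- Let X be a rearrangement invariant quasi-Banach space on ℝ. For every p > 0 there exist a number 0 < u ≤ p and a constant c > 0 such that for all f₁, f₂, …, f_n ∈ X one has ‖ ( Σ_{i=1}^n |f_i|^p )^{1/p} ‖_X ≤ c ( Σ_{i=1}^n ‖f_i‖_X^u )^{1/u}. -/
open MeasureTheory Set Filter Topology ENNReal

noncomputable section

/-- The decreasing rearrangement of an `ℝ≥0∞`-valued function with respect to a measure `μ`:
`g⁎(s) = sup {t : μ {x | g x > t} > s}`. -/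
def distRearr {α : Type*} [MeasurableSpace α] (μ : Measure α) (g : α → ℝ≥0∞) (s : ℝ) : ℝ≥0∞ :=
  sSup {t : ℝ≥0∞ | ENNReal.ofReal s < μ {x | t < g x}}

/-- Decreasing rearrangement of an `ℝ≥0∞`-valued function on `ℝ` (Lebesgue measure). -/
def rearrE (g : ℝ → ℝ≥0∞) : ℝ → ℝ≥0∞ := distRearr (volume : Measure ℝ) g

/-- Decreasing rearrangement `f^*` of a real-valued function on `ℝ`:
`f^*(s) = sup {t ≥ 0 : volume {x : |f x| > t} > s}`. -/
def rearr (f : ℝ → ℝ) : ℝ → ℝ≥0∞ := rearrE fun x => ENNReal.ofReal |f x|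

/-- The dilation operator `D_a f (t) = f (a t)`. -/
def dil (a : ℝ) (f : ℝ → ℝ) : ℝ → ℝ := fun t => f (a * t)

/-- The dilation operator on `ℝ≥0∞`-valued functions. -/
def dilE (a : ℝ) (g : ℝ → ℝ≥0∞) : ℝ → ℝ≥0∞ := fun t => g (a * t)

/-- A rearrangement invariant quasi-Banach function space on `ℝ` (with Lebesgue measure).
The quasi-norm `N` is defined on all `ℝ≥0∞`-valued functions (a signed function `f`
is measured via `|f|`, embedded into `ℝ≥0∞`; this is harmless since the quasi-norm of a
rearrangement invariant space depends only on `|f|`).  Membership of a signed function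
`f` in the space means `f` is measurable with `N (|f|) < ∞`. -/
structure RIQB where
  /-- the quasi-norm -/
  N : (ℝ → ℝ≥0∞) → ℝ≥0∞
  /-- the quasi-triangle inequality constant -/
  C : ℝ
  one_le_C : 1 ≤ C
  /-- homogeneity of the quasi-norm -/
  norm_smul : ∀ (c : ℝ≥0∞) (g : ℝ → ℝ≥0∞), N (fun x => c * g x) = c * N g
  /-- the quasi-triangle inequality -/
  quasi_triangle : ∀ g h : ℝ → ℝ≥0∞, AEMeasurable g volume → AEMeasurable h volume →
    N (fun x => g x + h x) ≤ ENNReal.ofReal C * (N g + N h)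
  /-- definiteness (functions are identified a.e.) -/
  definite : ∀ g : ℝ → ℝ≥0∞, AEMeasurable g volume → (N g = 0 ↔ g =ᵐ[volume] 0)
  /-- property (i): if `h^* ≤ g^*` then `‖h‖ ≤ ‖g‖` -/
  rearr_mono : ∀ g h : ℝ → ℝ≥0∞, AEMeasurable g volume → AEMeasurable h volume →
    (∀ s : ℝ, 0 < s → rearrE h s ≤ rearrE g s) → N h ≤ N g
  /-- property (ii): simple functions with support of finite measure belong to the space -/
  simple_mem : ∀ f : MeasureTheory.SimpleFunc ℝ ℝ,
    volume (Function.support (f : ℝ → ℝ)) < ∞ → N (fun x => ENNReal.ofReal |f x|) < ∞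
  /-- property (iii) or (iii′) -/
  fatou :
    (∀ g : ℕ → ℝ → ℝ≥0∞, (∀ n, AEMeasurable (g n) volume ∧ N (g n) < ∞) →
      (∀ x, Antitone fun n => g n x) → (∀ x, Tendsto (fun n => g n x) atTop (𝓝 0)) →
      Tendsto (fun n => N (g n)) atTop (𝓝 0)) ∨
    (∀ (g : ℕ → ℝ → ℝ≥0∞) (h : ℝ → ℝ≥0∞),
      (∀ n, AEMeasurable (g n) volume ∧ N (g n) < ∞) →
      (∀ x, Monotone fun n => g n x) → (∀ x, Tendsto (fun n => g n x) atTop (𝓝 (h x))) →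
      (⨆ n, N (g n)) < ∞ → N h = ⨆ n, N (g n))
  /-- completeness of the quasi-norm -/
  complete : ∀ f : ℕ → ℝ → ℝ,
    (∀ n, AEMeasurable (f n) volume ∧ N (fun x => ENNReal.ofReal |f n x|) < ∞) →
    (∀ ε : ℝ, 0 < ε → ∃ M : ℕ, ∀ m ≥ M, ∀ n ≥ M,
      N (fun x => ENNReal.ofReal |f m x - f n x|) < ENNReal.ofReal ε) →
    ∃ g : ℝ → ℝ, AEMeasurable g volume ∧ N (fun x => ENNReal.ofReal |g x|) < ∞ ∧
      Tendsto (fun n => N (fun x => ENNReal.ofReal |f n x - g x|)) atTop (𝓝 0)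

/-- The quasi-norm of a signed function. -/
def RIQB.Nr (X : RIQB) (f : ℝ → ℝ) : ℝ≥0∞ := X.N fun x => ENNReal.ofReal |f x|

/-- Membership in the space. -/
def RIQB.mem (X : RIQB) (f : ℝ → ℝ) : Prop := AEMeasurable f volume ∧ X.Nr f < ∞

/-- The lower Boyd index of a quasi-norm functional:
`sup {p > 0 : ∃ c > 0, ∀ 0 < a < 1, ∀ f ∈ X, ‖D_a f‖ ≤ c a^(-1/p) ‖f‖}`. -/
def lowerBoydOf (N : (ℝ → ℝ) → ℝ≥0∞) : ℝ≥0∞ :=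
  ⨆ p ∈ {p : ℝ | 0 < p ∧ ∃ c : ℝ, 0 < c ∧ ∀ a : ℝ, 0 < a → a < 1 →
      ∀ f : ℝ → ℝ, AEMeasurable f volume → N f < ∞ →
        N (dil a f) ≤ ENNReal.ofReal (c * a ^ (-(1/p))) * N f},
    ENNReal.ofReal p

/-- The upper Boyd index of a quasi-norm functional:
`inf {q > 0 : ∃ c > 0, ∀ a > 1, ∀ f ∈ X, ‖D_a f‖ ≤ c a^(-1/q) ‖f‖}`. -/
def upperBoydOf (N : (ℝ → ℝ) → ℝ≥0∞) : ℝ≥0∞ :=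
  ⨅ q ∈ {q : ℝ | 0 < q ∧ ∃ c : ℝ, 0 < c ∧ ∀ a : ℝ, 1 < a →
      ∀ f : ℝ → ℝ, AEMeasurable f volume → N f < ∞ →
        N (dil a f) ≤ ENNReal.ofReal (c * a ^ (-(1/q))) * N f},
    ENNReal.ofReal q

/-- The lower Boyd index `p_X`. -/
def lowerBoyd (X : RIQB) : ℝ≥0∞ := lowerBoydOf X.Nr

/-- The upper Boyd index `q_X`. -/
def upperBoyd (X : RIQB) : ℝ≥0∞ := upperBoydOf X.Nr

/-- The Hardy operator `H^{(p,r)}` acting on a nonnegative (`ℝ≥0∞`-valued) function: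
`t^{-1/p} ((r/p) ∫₀ᵗ g(s)^r s^{r/p-1} ds)^{1/r}` for `t > 0`, and `0` for `t ≤ 0`. -/
def hardyUE (p r : ℝ) (g : ℝ → ℝ≥0∞) : ℝ → ℝ≥0∞ := fun t =>
  if 0 < t then
    ENNReal.ofReal t ^ (-(1/p)) *
      (ENNReal.ofReal (r/p) *
        ∫⁻ s in Ioo (0:ℝ) t, g s ^ r * ENNReal.ofReal (s ^ (r/p - 1))) ^ (1/r)
  else 0

/-- The Hardy operator `H^{(p,r)} f (t) = t^{-1/p} ((r/p) ∫₀ᵗ f^*(s)^r s^{r/p-1} ds)^{1/r}`. -/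
def hardyU (p r : ℝ) (f : ℝ → ℝ) : ℝ → ℝ≥0∞ := hardyUE p r (rearr f)

/-- The Hardy operator `H^{(p,∞)} f (t) = sup_{0<s<t} (s/t)^{1/p} f^*(s)`. -/
def hardyUSup (p : ℝ) (f : ℝ → ℝ) : ℝ → ℝ≥0∞ := fun t =>
  if 0 < t then ⨆ s ∈ Ioo (0:ℝ) t, ENNReal.ofReal ((s/t) ^ (1/p)) * rearr f s else 0

/-- The Hardy operator
`H_{(q,r)} f (t) = t^{-1/q} ((r/q) ∫_t^∞ f^*(s)^r s^{r/q-1} ds)^{1/r}` for finite `q`. -/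
def hardyL (q r : ℝ) (f : ℝ → ℝ) : ℝ → ℝ≥0∞ := fun t =>
  if 0 < t then
    ENNReal.ofReal t ^ (-(1/q)) *
      (ENNReal.ofReal (r/q) *
        ∫⁻ s in Ioi t, rearr f s ^ r * ENNReal.ofReal (s ^ (r/q - 1))) ^ (1/r)
  else 0

/-- The Hardy operator `H_{(∞,r)} f (t) = (∫_t^∞ f^*(s)^r s⁻¹ ds)^{1/r}`. -/
def hardyLInf (r : ℝ) (f : ℝ → ℝ) : ℝ → ℝ≥0∞ := fun t =>
  if 0 < t then (∫⁻ s in Ioi t, rearr f s ^ r * ENNReal.ofReal s⁻¹) ^ (1/r) else 0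

/-- The Hardy operator `H_{(q,r)}` for `0 < q ≤ ∞`, `0 < r < ∞`. -/
def hardyLG (q : ℝ≥0∞) (r : ℝ) (f : ℝ → ℝ) : ℝ → ℝ≥0∞ :=
  if q = ∞ then hardyLInf r f else hardyL q.toReal r f

/-- The Hardy operator `H_{(q,∞)} f (t) = sup_{s>t} (s/t)^{1/q} f^*(s)`. -/
def hardyLSup (q : ℝ) (f : ℝ → ℝ) : ℝ → ℝ≥0∞ := fun t =>
  if 0 < t then ⨆ s ∈ Ioi t, ENNReal.ofReal ((s/t) ^ (1/q)) * rearr f s else 0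

/-- The Hardy operator `H^{(p,r)}` for `0 < p < ∞`, `0 < r ≤ ∞`. -/
def hardyUG (p : ℝ) (r : ℝ≥0∞) (f : ℝ → ℝ) : ℝ → ℝ≥0∞ :=
  if r = ∞ then hardyUSup p f else hardyU p r.toReal f

/-- The Hardy operator `H_{(q,s)}` for `0 < q ≤ ∞`, `0 < s ≤ ∞`
(with `H_{(∞,∞)} f = f^*`). -/
def hardyLGG (q s : ℝ≥0∞) (f : ℝ → ℝ) : ℝ → ℝ≥0∞ :=
  if q = ∞ then
    (if s = ∞ then (fun t => if 0 < t then rearr f t else 0) else hardyLInf s.toReal f)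
  else
    (if s = ∞ then hardyLSup q.toReal f else hardyL q.toReal s.toReal f)

/-- The Lorentz quasi-norm `‖f‖_{p,r}` for `0 < p ≤ ∞`, `0 < r ≤ ∞`. -/
def lorentz (p r : ℝ≥0∞) (f : ℝ → ℝ) : ℝ≥0∞ :=
  if p = ∞ then
    (if r = ∞ then essSup (fun x => ENNReal.ofReal |f x|) volume
     else (∫⁻ t in Ioi (0:ℝ), rearr f t ^ r.toReal * ENNReal.ofReal t⁻¹) ^ (1/r.toReal))
  else
    (if r = ∞ then ⨆ t ∈ Ioi (0:ℝ), ENNReal.ofReal t ^ (1/p.toReal) * rearr f t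
     else (∫⁻ t in Ioi (0:ℝ),
        (ENNReal.ofReal t ^ (1/p.toReal) * rearr f t) ^ r.toReal * ENNReal.ofReal t⁻¹) ^
          (1/r.toReal))

/-- The weak-`L_p` (Lorentz `(p,∞)`) quasi-norm of an `ℝ≥0∞`-valued function on `ℝ`:
`sup_{t>0} t^{1/p} g^*(t)`. -/
def lorentzWE (p : ℝ) (g : ℝ → ℝ≥0∞) : ℝ≥0∞ :=
  ⨆ t ∈ Ioi (0:ℝ), ENNReal.ofReal t ^ (1/p) * rearrE g t

/-- A chain inequality in the style of Frink: a functional on intervals of `ℕ` satisfying a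
three-piece quasi-ultrametric inequality with constant `2` is bounded by twice the sum of its
values on unit intervals. -/
theorem interval_le_two_mul_sum (F : ℕ → ℕ → ℝ≥0∞) (a : ℕ → ℝ≥0∞)
    (hself : ∀ m, F m m = 0) (hunit : ∀ m, F m (m + 1) ≤ a m)
    (hsplit : ∀ m k n, m ≤ k → k < n →
      F m n ≤ 2 * max (F m k) (max (F k (k + 1)) (F (k + 1) n)))
    {m n : ℕ} (hmn : m ≤ n) : F m n ≤ 2 * ∑ i ∈ Finset.Ico m n, a i := by
  induction hd : n - m using Nat.strong_induction_on generalizing m n with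
  | _ d ih =>
  rcases hmn.eq_or_lt with rfl | hlt
  · simp [hself]
  set S := ∑ i ∈ Finset.Ico m n, a i with hS
  rcases eq_or_ne S ∞ with htop | htop
  · simp [htop]
  let p : ℕ → Prop := fun k => m ≤ k ∧ 2 * ∑ i ∈ Finset.Ico m k, a i ≤ S
  have hpm : p m := by simp [p]
  classical
  let k := Nat.findGreatest p (n - 1)
  have hk : p k := Nat.findGreatest_spec (P := p) (by omega : m ≤ n - 1) hpm
  have hkle : k ≤ n - 1 := Nat.findGreatest_le _
  have hkn : k < n := by omega
  have hleft : F m k ≤ S := (ih (k - m) (by omega) hk.1 rfl).trans hk.2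
  have hmid : F k (k + 1) ≤ S := (hunit k).trans
    (Finset.single_le_sum (f := a) (fun _ _ => zero_le) (Finset.mem_Ico.2 ⟨hk.1, hkn⟩))
  have hright : F (k + 1) n ≤ S := by
    have := hk.1
    refine (ih (n - (k + 1)) (by omega) (by omega) rfl).trans ?_
    rcases eq_or_ne (k + 1) n with heq | hne
    · simp [heq]
    have hnp : ¬ p (k + 1) :=
      Nat.findGreatest_is_greatest (Nat.lt_succ_self k) (by omega)
    have hgt : S < 2 * ∑ i ∈ Finset.Ico m (k + 1), a i := by
      by_contra h
      exact hnp ⟨by omega, not_lt.1 h⟩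
    by_contra! h
    have hadd := ENNReal.add_lt_add hgt h
    rw [← mul_add, Finset.sum_Ico_consecutive _ (by omega : m ≤ k + 1) (by omega), ← hS,
      two_mul] at hadd
    exact lt_irrefl _ hadd
  exact (hsplit m k n hk.1 hkn).trans
    (mul_le_mul_right (max_le hleft (max_le hmid hright)) 2)

theorem rearrE_mono {g h : ℝ → ℝ≥0∞} (hgh : g ≤ h) (s : ℝ) : rearrE g s ≤ rearrE h s :=
  sSup_le_sSup fun _ ht => lt_of_lt_of_le ht (measure_mono fun x hx => lt_of_lt_of_le hx (hgh x))

namespace RIQB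

theorem N_mono (X : RIQB) {g h : ℝ → ℝ≥0∞} (hg : AEMeasurable g volume)
    (hh : AEMeasurable h volume) (hgh : g ≤ h) : X.N g ≤ X.N h :=
  X.rearr_mono h g hh hg fun s _ => rearrE_mono hgh s

theorem N_zero (X : RIQB) : X.N (fun _ => 0) = 0 := by
  simpa using X.norm_smul 0 fun _ => 0

theorem N_add_rpow_le (X : RIQB) {r : ℝ} (hr : 0 < r) {g h : ℝ → ℝ≥0∞}
    (hg : AEMeasurable g volume) (hh : AEMeasurable h volume) :
    X.N (fun x => (g x + h x) ^ r) ≤ 2 ^ r * (ENNReal.ofReal X.C * 2) *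
      max (X.N fun x => g x ^ r) (X.N fun x => h x ^ r) := by
  have hg' := hg.pow_const r
  have hh' := hh.pow_const r
  calc X.N (fun x => (g x + h x) ^ r)
      ≤ X.N (fun x => 2 ^ r * (g x ^ r + h x ^ r)) := by
        refine X.N_mono ((hg.add hh).pow_const r) ((hg'.add hh').const_mul _) fun x => ?_
        calc (g x + h x) ^ r ≤ (2 * max (g x) (h x)) ^ r := by
              rw [two_mul]
              gcongr
              · exact le_max_left _ _
              · exact le_max_right _ _
          _ = 2 ^ r * max (g x) (h x) ^ r := ENNReal.mul_rpow_of_nonneg _ _ hr.le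
          _ ≤ 2 ^ r * (g x ^ r + h x ^ r) := by
              gcongr
              rcases max_choice (g x) (h x) with h' | h' <;> rw [h']
              · exact le_self_add
              · exact le_add_self
    _ = 2 ^ r * X.N (fun x => g x ^ r + h x ^ r) := X.norm_smul _ _
    _ ≤ 2 ^ r * (ENNReal.ofReal X.C *
          ((X.N fun x => g x ^ r) + X.N fun x => h x ^ r)) := by
        gcongr
        exact X.quasi_triangle _ _ hg' hh'
    _ ≤ 2 ^ r * (ENNReal.ofReal X.C *
          (2 * max (X.N fun x => g x ^ r) (X.N fun x => h x ^ r))) := by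
        rw [two_mul (max _ _)]
        gcongr
        · exact le_max_left _ _
        · exact le_max_right _ _
    _ = _ := by ring

/-- The Aoki–Rolewicz inequality for the functional `g ↦ ‖g ^ r‖`. -/
theorem N_sum_rpow_le (X : RIQB) {r u : ℝ} (hr : 0 < r) (hu : 0 < u)
    (hD : ((2 ^ r * (ENNReal.ofReal X.C * 2)) ^ 2) ^ u ≤ 2)
    (g : ℕ → ℝ → ℝ≥0∞) (hg : ∀ i, AEMeasurable (g i) volume) (n : ℕ) :
    X.N (fun x => (∑ i ∈ Finset.range n, g i x) ^ r) ^ u ≤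
      2 * ∑ i ∈ Finset.range n, X.N (fun x => g i x ^ r) ^ u := by
  set D : ℝ≥0∞ := 2 ^ r * (ENNReal.ofReal X.C * 2)
  have hD1 : 1 ≤ D := by
    have hC : 1 ≤ ENNReal.ofReal X.C := ENNReal.one_le_ofReal.2 X.one_le_C
    have h2 : (1 : ℝ≥0∞) ≤ 2 ^ r := ENNReal.one_le_rpow one_le_two hr
    exact one_le_mul h2 (one_le_mul hC one_le_two)
  have hsum (m k : ℕ) : AEMeasurable (fun x => ∑ i ∈ Finset.Ico m k, g i x) volume :=
    Finset.aemeasurable_fun_sum _ fun i _ => hg i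
  have key := interval_le_two_mul_sum
    (fun m k => X.N (fun x => (∑ i ∈ Finset.Ico m k, g i x) ^ r) ^ u)
    (fun i => X.N (fun x => g i x ^ r) ^ u)
    (fun m => by simp [hr, hu, X.N_zero]) (fun m => by simp) ?_ (Nat.zero_le n)
  · simpa using key
  intro m k n hmk hkn
  have hsplit₁ : (fun x => (∑ i ∈ Finset.Ico m n, g i x) ^ r) =
      fun x => (∑ i ∈ Finset.Ico m k, g i x + ∑ i ∈ Finset.Ico k n, g i x) ^ r := by
    funext x
    rw [Finset.sum_Ico_consecutive _ hmk hkn.le]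
  have hsplit₂ : (fun x => (∑ i ∈ Finset.Ico k n, g i x) ^ r) =
      fun x => (∑ i ∈ Finset.Ico k (k + 1), g i x + ∑ i ∈ Finset.Ico (k + 1) n, g i x) ^ r := by
    funext x
    rw [Finset.sum_Ico_consecutive _ k.le_succ hkn]
  have h₁ := X.N_add_rpow_le hr (hsum m k) (hsum k n)
  have h₂ := X.N_add_rpow_le hr (hsum k (k + 1)) (hsum (k + 1) n)
  rw [← hsplit₁] at h₁
  rw [← hsplit₂] at h₂
  set A := X.N fun x => (∑ i ∈ Finset.Ico m k, g i x) ^ r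
  set B := X.N fun x => (∑ i ∈ Finset.Ico k (k + 1), g i x) ^ r
  set E := X.N fun x => (∑ i ∈ Finset.Ico (k + 1) n, g i x) ^ r
  have hmono : Monotone fun t : ℝ≥0∞ => t ^ u := ENNReal.monotone_rpow_of_nonneg hu.le
  have h₃ : X.N (fun x => (∑ i ∈ Finset.Ico m n, g i x) ^ r) ≤ D ^ 2 * max A (max B E) := by
    refine h₁.trans ?_
    rw [sq, mul_assoc D D]
    refine mul_le_mul_right (max_le ?_ (h₂.trans ?_)) D
    · exact (le_max_left _ _).trans (le_mul_of_one_le_left' hD1)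
    · exact mul_le_mul_right (le_max_right _ _) D
  calc _ ≤ (D ^ 2 * max A (max B E)) ^ u := hmono h₃
    _ = (D ^ 2) ^ u * max A (max B E) ^ u := ENNReal.mul_rpow_of_nonneg _ _ hu.le
    _ = (D ^ 2) ^ u * max (A ^ u) (max (B ^ u) (E ^ u)) := by
        rw [hmono.map_max, hmono.map_max]
    _ ≤ _ := mul_le_mul_left hD _

end RIQB

theorem exists_rpow_le_two {K : ℝ≥0∞} (hK : K ≠ ∞) {p : ℝ} (hp : 0 < p) :
    ∃ u : ℝ, 0 < u ∧ u ≤ p ∧ K ^ u ≤ 2 := by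
  obtain ⟨n, hn⟩ := ENNReal.exists_nat_gt hK
  have hn0 : n ≠ 0 := by
    rintro rfl
    simp at hn
  have hpos : (0 : ℝ) < n := by positivity
  refine ⟨min p (1 / n), by positivity, min_le_left _ _, ?_⟩
  have hle : K ≤ 2 ^ (n : ℝ) := by
    rw [ENNReal.rpow_natCast]
    exact hn.le.trans (by exact_mod_cast Nat.lt_two_pow_self.le)
  calc K ^ min p (1 / (n : ℝ)) ≤ (2 ^ (n : ℝ)) ^ min p (1 / (n : ℝ)) :=
        ENNReal.rpow_le_rpow hle (by positivity)
    _ = 2 ^ (n * min p (1 / (n : ℝ))) := (ENNReal.rpow_mul _ _ _).symm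
    _ ≤ 2 ^ (1 : ℝ) := by
        refine ENNReal.rpow_le_rpow_of_exponent_le one_le_two ?_
        calc n * min p (1 / (n : ℝ)) ≤ n * (1 / n) := by gcongr; exact min_le_right _ _
          _ = 1 := by field_simp
    _ = 2 := ENNReal.rpow_one 2

/-- **Lemma 6.** For every `p > 0` there are `0 < u ≤ p` and `c > 0` such that
`‖(∑ |fᵢ|^p)^{1/p}‖_X ≤ c (∑ ‖fᵢ‖_X^u)^{1/u}` for all `f₁, …, f_n ∈ X`. -/
theorem riqb_p_sum_estimate (X : RIQB) (p : ℝ) (hp : 0 < p) :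
    ∃ u c : ℝ, 0 < u ∧ u ≤ p ∧ 0 < c ∧
      ∀ (n : ℕ) (f : Fin n → ℝ → ℝ), (∀ i, X.mem (f i)) →
        X.N (fun x => (∑ i, ENNReal.ofReal |f i x| ^ p) ^ (1/p)) ≤
          ENNReal.ofReal c * (∑ i, X.Nr (f i) ^ u) ^ (1/u) := by
  have hr : 0 < 1 / p := by positivity
  have htop : ((2 : ℝ≥0∞) ^ (1 / p) * (ENNReal.ofReal X.C * 2)) ^ 2 ≠ ∞ :=
    ENNReal.pow_ne_top (ENNReal.mul_ne_top
      (ENNReal.rpow_ne_top_of_nonneg hr.le ENNReal.ofNat_ne_top)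
      (ENNReal.mul_ne_top ENNReal.ofReal_ne_top ENNReal.ofNat_ne_top))
  obtain ⟨u, hu, hup, hD⟩ := exists_rpow_le_two htop hp
  refine ⟨u, 2 ^ (1 / u), hu, hup, by positivity, fun n f hf => ?_⟩
  let g : ℕ → ℝ → ℝ≥0∞ := fun i x => if h : i < n then ENNReal.ofReal |f ⟨i, h⟩ x| ^ p else 0
  have hg (i : ℕ) : AEMeasurable (g i) volume := by
    by_cases h : i < n
    · simpa [g, h] using (hf ⟨i, h⟩).1.abs.ennreal_ofReal.pow_const p
    · simp [g, h]
  have hgf (i : Fin n) (x : ℝ) : g i x = ENNReal.ofReal |f i x| ^ p := by simp [g]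
  have key := X.N_sum_rpow_le hr hu hD g hg n
  simp only [Finset.sum_range, hgf, ← ENNReal.rpow_mul, mul_one_div_cancel hp.ne',
    ENNReal.rpow_one] at key
  calc _ ≤ (2 * ∑ i, X.Nr (f i) ^ u) ^ (1 / u) := by
        rw [one_div u]
        exact (ENNReal.le_rpow_inv_iff hu).2 key
    _ = _ := by
        rw [ENNReal.mul_rpow_of_nonneg _ _ (by positivity),
          ← ENNReal.ofReal_rpow_of_pos two_pos, ENNReal.ofReal_ofNat]
end
end

section
/- Let g : (0,∞) → [0,∞) be nonincreasing, and define E g(x) = g(x) for 0 ≤ x < 1 and E g(x) = 0 for x ≥ 1, and F g(x) = 0 for 0 ≤ x < 1 and F g(x) = ∫_n^{n+1} g(s) ds for n ≤ x < n+1 with n a positive integer. Then for all x > 0: g(2x) ≤ (E + F) g(x) ≤ g(x/2). -/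
open MeasureTheory Set Filter Topology ENNReal

noncomputable section

/-- The truncation operator `E`: `E g = g` on `[0,1)` and `0` on `[1,∞)`. -/
def Eop (g : ℝ → ℝ) (x : ℝ) : ℝ := if x < 1 then g x else 0

/-- The averaging operator `F`: `F g = 0` on `[0,1)`, and on `[n, n+1)` (`n ≥ 1` an integer)
`F g` is the constant `∫_n^{n+1} g(s) ds`. -/
def Fop (g : ℝ → ℝ) (x : ℝ) : ℝ :=
  if x < 1 then 0 else ∫ s in ((⌊x⌋ : ℝ))..((⌊x⌋ : ℝ) + 1), g s

/-- The integral of an antitone function over `[a, a + 1]` lies between its values at the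
endpoints. -/
theorem AntitoneOn.le_integral_unit_le {g : ℝ → ℝ} {a : ℝ} (h : AntitoneOn g (Set.Icc a (a + 1))) :
    g (a + 1) ≤ ∫ s in a..(a + 1), g s ∧ ∫ s in a..(a + 1), g s ≤ g a := by
  have hle : a ≤ a + 1 := by linarith
  have hi : IntervalIntegrable g volume a (a + 1) :=
    AntitoneOn.intervalIntegrable (by rwa [Set.uIcc_of_le hle])
  constructor
  · have := intervalIntegral.integral_mono_on hle
      (intervalIntegrable_const (c := g (a + 1))) hi
      fun s hs => h hs (Set.right_mem_Icc.2 hle) hs.2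
    simpa using this
  · have := intervalIntegral.integral_mono_on hle hi
      (intervalIntegrable_const (c := g a))
      fun s hs => h (Set.left_mem_Icc.2 hle) hs hs.1
    simpa using this

/-- For a nonnegative nonincreasing `g` on `(0,∞)`: `g(2x) ≤ (E + F) g (x) ≤ g(x/2)`. -/
theorem Eop_add_Fop_bounds (g : ℝ → ℝ) (hg0 : ∀ x : ℝ, 0 < x → 0 ≤ g x)
    (hgmono : ∀ x y : ℝ, 0 < x → x ≤ y → g y ≤ g x) (x : ℝ) (hx : 0 < x) :
    g (2 * x) ≤ Eop g x + Fop g x ∧ Eop g x + Fop g x ≤ g (x / 2) := by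
  by_cases h1 : x < 1
  · simp only [Eop, Fop, if_pos h1, add_zero]
    exact ⟨hgmono _ _ hx (by linarith), hgmono _ _ (by linarith) (by linarith)⟩
  · simp only [Eop, Fop, if_neg h1, zero_add]
    have hn : (1 : ℝ) ≤ (⌊x⌋ : ℝ) := by
      exact_mod_cast Int.le_floor.2 (by exact_mod_cast not_lt.1 h1)
    have hfl : (⌊x⌋ : ℝ) ≤ x := Int.floor_le x
    have hlt : x < (⌊x⌋ : ℝ) + 1 := Int.lt_floor_add_one x
    have hanti : AntitoneOn g (Set.Icc (⌊x⌋ : ℝ) ((⌊x⌋ : ℝ) + 1)) :=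
      fun s hs t _ hst => hgmono s t (by linarith [hs.1]) hst
    obtain ⟨hlow, hup⟩ := hanti.le_integral_unit_le
    exact ⟨(hgmono _ _ (by linarith) (by linarith)).trans hlow,
      hup.trans (hgmono _ _ (by linarith) (by linarith))⟩

end
end

section
/- (Iteration formula for the Hardy operator) Let 0 < p < ∞ and 0 < r < ∞ and let f be a measurable function on ℝ with decreasing rearrangement f^*. Then for every integer n ≥ 0 and every t > 0, the (n+1)-fold iterate of H^{(p,r)} applied to f satisfies (H^{(p,r)})^{n+1} f(t) = t^{-1/p} ( (r/p) ∫₀^t ( ((r/p) log(t/s))^n / n! ) f^*(s)^r s^{r/p - 1} ds )^{1/r}. -/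
open MeasureTheory Set Filter Topology ENNReal

noncomputable section

theorem antitone_rearr (f : ℝ → ℝ) : Antitone (rearr f) := fun _ _ hab =>
  sSup_le_sSup fun _ h => (ENNReal.ofReal_le_ofReal hab).trans_lt h

/-- The integral `∫_u^t (c / s) (c log (s / u))ⁿ / n! ds = (c log (t / u))ⁿ⁺¹ / (n+1)!`. -/
theorem lintegral_log_pow_div_factorial {c u t : ℝ} (hc : 0 ≤ c) (hu : 0 < u) (hut : u ≤ t)
    (n : ℕ) :
    ∫⁻ s in Ioo u t, ENNReal.ofReal (c / s) *
        (ENNReal.ofReal (c * Real.log (s / u)) ^ n / (Nat.factorial n : ℝ≥0∞)) =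
      ENNReal.ofReal (c * Real.log (t / u)) ^ (n + 1) / (Nat.factorial (n + 1) : ℝ≥0∞) := by
  have log_nonneg : ∀ s, u ≤ s → 0 ≤ c * Real.log (s / u) := fun s hs =>
    mul_nonneg hc (Real.log_nonneg ((one_le_div hu).2 hs))
  have ofReal_pow_div : ∀ (x : ℝ) (m : ℕ), 0 ≤ x →
      ENNReal.ofReal x ^ m / (Nat.factorial m : ℝ≥0∞) =
        ENNReal.ofReal (x ^ m / (Nat.factorial m : ℝ)) := by
    intro x m hx
    rw [ENNReal.ofReal_div_of_pos (by positivity), ENNReal.ofReal_pow hx, ENNReal.ofReal_natCast]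
  have hcont : ContinuousOn
      (fun s : ℝ => c / s * ((c * Real.log (s / u)) ^ n / (Nat.factorial n : ℝ))) (Icc u t) := by
    have h0 : ∀ s ∈ Icc u t, s ≠ 0 := fun s hs => (hu.trans_le hs.1).ne'
    have h1 : ∀ s ∈ Icc u t, s / u ≠ 0 := fun s hs => div_ne_zero (h0 s hs) hu.ne'
    fun_prop (disch := assumption)
  have hderiv : ∀ s ∈ uIcc u t, HasDerivAt
      (fun s : ℝ => (c * Real.log (s / u)) ^ (n + 1) / (Nat.factorial (n + 1) : ℝ))
      (c / s * ((c * Real.log (s / u)) ^ n / (Nat.factorial n : ℝ))) s := by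
    intro s hs
    rw [uIcc_of_le hut] at hs
    have hs0 : 0 < s := hu.trans_le hs.1
    have h := (((((hasDerivAt_id s).div_const u).log
      (div_ne_zero hs0.ne' hu.ne')).const_mul c).pow (n + 1)).div_const
        (Nat.factorial (n + 1) : ℝ)
    refine h.congr_deriv ?_
    have hn : (Nat.factorial n : ℝ) ≠ 0 := by positivity
    have hn' : (n + 1 : ℝ) ≠ 0 := by positivity
    simp only [id, Nat.factorial_succ, Nat.add_sub_cancel]
    push_cast
    field_simp
  have hint := intervalIntegral.integral_eq_sub_of_hasDerivAt hderiv
    (hcont.intervalIntegrable_of_Icc hut)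
  rw [intervalIntegral.integral_of_le hut, integral_Ioc_eq_integral_Ioo] at hint
  rw [ofReal_pow_div _ _ (log_nonneg t hut)]
  simp only [div_self hu.ne', Real.log_one, mul_zero, ne_eq, Nat.add_eq_zero_iff, one_ne_zero,
    and_false, not_false_eq_true, zero_pow, zero_div, sub_zero] at hint
  rw [← hint, ofReal_integral_eq_lintegral_ofReal]
  · refine setLIntegral_congr_fun measurableSet_Ioo fun s hs => ?_
    have hs0 : 0 < s := hu.trans hs.1
    rw [ofReal_pow_div _ _ (log_nonneg s hs.1.le), ENNReal.ofReal_mul (by positivity)]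
  · exact hcont.integrableOn_Icc.mono_set Ioo_subset_Icc_self
  · refine (ae_restrict_iff' measurableSet_Ioo).2 (ae_of_all _ fun s hs => ?_)
    have hs0 : 0 < s := hu.trans hs.1
    have := log_nonneg s hs.1.le
    simp only [Pi.zero_apply]
    positivity

/-- Tonelli's theorem on the triangle `a < u < s < b`. -/
theorem lintegral_Ioo_lintegral_Ioo_swap {a b : ℝ} {K : ℝ → ℝ → ℝ≥0∞}
    (hK : Measurable (Function.uncurry K)) :
    ∫⁻ s in Ioo a b, ∫⁻ u in Ioo a s, K s u = ∫⁻ u in Ioo a b, ∫⁻ s in Ioo u b, K s u := by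
  have hmeas : Measurable (Function.uncurry fun s u : ℝ =>
      {q : ℝ × ℝ | q.2 < q.1}.indicator (Function.uncurry K) (s, u)) :=
    hK.indicator (measurableSet_lt measurable_snd measurable_fst)
  calc ∫⁻ s in Ioo a b, ∫⁻ u in Ioo a s, K s u
      = ∫⁻ s in Ioo a b, ∫⁻ u in Ioo a b,
          {q : ℝ × ℝ | q.2 < q.1}.indicator (Function.uncurry K) (s, u) := by
        refine setLIntegral_congr_fun measurableSet_Ioo fun s hs => ?_
        have hset : Ioo a s = Iio s ∩ Ioo a b := by
          ext u
          simp only [mem_Ioo, mem_inter_iff, mem_Iio]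
          constructor
          · exact fun h => ⟨h.2, h.1, h.2.trans hs.2⟩
          · exact fun h => ⟨h.2.1, h.1⟩
        rw [hset, ← setLIntegral_indicator measurableSet_Iio]
        rfl
    _ = ∫⁻ u in Ioo a b, ∫⁻ s in Ioo a b,
          {q : ℝ × ℝ | q.2 < q.1}.indicator (Function.uncurry K) (s, u) :=
        lintegral_lintegral_swap hmeas.aemeasurable
    _ = ∫⁻ u in Ioo a b, ∫⁻ s in Ioo u b, K s u := by
        refine setLIntegral_congr_fun measurableSet_Ioo fun u hu => ?_
        have hset : Ioo u b = Ioi u ∩ Ioo a b := by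
          ext s
          simp only [mem_Ioo, mem_inter_iff, mem_Ioi]
          constructor
          · exact fun h => ⟨h.1, hu.1.trans h.1, h.2⟩
          · exact fun h => ⟨h.1, h.2.2⟩
        rw [hset, ← setLIntegral_indicator measurableSet_Ioi]
        rfl

/-- Integrating `c / s` against the `n`-th logarithmic kernel produces the `(n+1)`-st one. -/
theorem lintegral_div_mul_lintegral_log_pow {c : ℝ} (hc : 0 ≤ c) {φ : ℝ → ℝ≥0∞}
    (hφ : Measurable φ) (n : ℕ) (t : ℝ) :
    ∫⁻ s in Ioo (0:ℝ) t, ENNReal.ofReal (c / s) * ∫⁻ u in Ioo (0:ℝ) s,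
        (ENNReal.ofReal (c * Real.log (s / u)) ^ n / (Nat.factorial n : ℝ≥0∞)) * φ u =
      ∫⁻ u in Ioo (0:ℝ) t,
        (ENNReal.ofReal (c * Real.log (t / u)) ^ (n + 1) / (Nat.factorial (n + 1) : ℝ≥0∞)) *
          φ u := by
  simp only [← lintegral_const_mul' _ _ ENNReal.ofReal_ne_top]
  rw [lintegral_Ioo_lintegral_Ioo_swap (K := fun s u => ENNReal.ofReal (c / s) *
    ((ENNReal.ofReal (c * Real.log (s / u)) ^ n / (Nat.factorial n : ℝ≥0∞)) * φ u))
    (by simp only [Function.uncurry_def]; fun_prop)]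
  refine setLIntegral_congr_fun measurableSet_Ioo fun u hu => ?_
  simp only [← mul_assoc]
  rw [lintegral_mul_const _ (by fun_prop), lintegral_log_pow_div_factorial hc hu.1 hu.2.le]

/-- **Iteration formula.** The `(n+1)`-fold iterate of the Hardy operator `H^{(p,r)}`:
`(H^{(p,r)})^{n+1} f (t) = t^{-1/p} ((r/p) ∫₀ᵗ (((r/p) log(t/s))ⁿ / n!) f^*(s)^r s^{r/p-1} ds)^{1/r}`. -/
theorem hardyU_iterate_formula (p r : ℝ) (hp : 0 < p) (hr : 0 < r)
    (f : ℝ → ℝ) (hf : Measurable f) (n : ℕ) (t : ℝ) (ht : 0 < t) :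
    (hardyUE p r)^[n] (hardyU p r f) t =
      ENNReal.ofReal t ^ (-(1/p)) *
        (ENNReal.ofReal (r/p) *
          ∫⁻ s in Ioo (0:ℝ) t,
            (ENNReal.ofReal ((r/p) * Real.log (t/s)) ^ n / (Nat.factorial n : ℝ≥0∞)) *
              (rearr f s ^ r * ENNReal.ofReal (s ^ (r/p - 1)))) ^ (1/r) := by
  induction n generalizing t with
  | zero => simp [hardyU, hardyUE, ht]
  | succ n ih =>
    have hφ : Measurable fun s => rearr f s ^ r * ENNReal.ofReal (s ^ (r/p - 1)) :=
      ((antitone_rearr f).measurable.pow_const r).mul (by fun_prop)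
    rw [Function.iterate_succ_apply', hardyUE, if_pos ht,
      ← lintegral_div_mul_lintegral_log_pow (div_pos hr hp).le hφ n t]
    congr 3
    refine setLIntegral_congr_fun measurableSet_Ioo fun s hs => ?_
    have hs0 : 0 < s := hs.1
    rw [ih s hs0, ENNReal.mul_rpow_of_nonneg _ _ hr.le, ← ENNReal.rpow_mul, ← ENNReal.rpow_mul,
      one_div_mul_cancel hr.ne', ENNReal.rpow_one, ENNReal.ofReal_rpow_of_pos hs0]
    have hcoef : ENNReal.ofReal (s ^ (-(1/p) * r)) * ENNReal.ofReal (s ^ (r/p - 1)) *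
        ENNReal.ofReal (r/p) = ENNReal.ofReal (r/p/s) := by
      rw [← ENNReal.ofReal_mul (by positivity), ← ENNReal.ofReal_mul (by positivity),
        ← Real.rpow_add hs0, show -(1/p) * r + (r/p - 1) = -1 by ring, Real.rpow_neg_one]
      congr 1
      ring
    rw [← hcoef]
    ring

end
end

section
/- Let 0 < p < ∞, 0 < r < ∞, and let f be a measurable function on ℝ with decreasing rearrangement f^*. Then for every integer n ≥ 0, every 0 < a < 1, and every t > 0: (H^{(p,r)})^{n+1} f(t) ≥ ( a^{r/p} ((r/p) log(1/a))^n / n! )^{1/r} f^*(a t). -/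
open MeasureTheory Set Filter Topology ENNReal

noncomputable section

lemma antitone_distRearr {α : Type*} [MeasurableSpace α] (μ : Measure α) (g : α → ℝ≥0∞) :
    Antitone (distRearr μ g) := fun _ _ h =>
  sSup_le_sSup fun _ hx => (ENNReal.ofReal_le_ofReal h).trans_lt hx

/-- A pointwise lower bound for the integrand of `hardyUE` on a subinterval `(u, v)` of `(0, t)`,
given by a function with an explicit antiderivative, bounds `hardyUE` from below. -/
lemma le_hardyUE_of_hasDerivAt {p r u v t : ℝ} (hr : 0 < r) (hu : 0 ≤ u)
    (huv : u ≤ v) (hvt : v ≤ t) (ht : 0 < t) {g : ℝ → ℝ≥0∞} {A : ℝ≥0∞} {Φ φ : ℝ → ℝ}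
    (hcont : ContinuousOn Φ (Icc u v)) (hderiv : ∀ s ∈ Ioo u v, HasDerivAt Φ (φ s) s)
    (hpos : ∀ s ∈ Ioo u v, 0 ≤ φ s)
    (hle : ∀ s ∈ Ioo u v, ENNReal.ofReal (φ s) * A ≤
      ENNReal.ofReal (r / p) * (g s ^ r * ENNReal.ofReal (s ^ (r / p - 1)))) :
    (ENNReal.ofReal (t ^ (-(r / p)) * (Φ v - Φ u)) * A) ^ (1 / r) ≤ hardyUE p r g t := by
  have hint : IntegrableOn φ (Ioc u v) :=
    intervalIntegral.integrableOn_deriv_of_nonneg hcont hderiv hpos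
  have hΦ : ENNReal.ofReal (Φ v - Φ u) = ∫⁻ s in Ioo u v, ENNReal.ofReal (φ s) := by
    rw [← intervalIntegral.integral_eq_sub_of_hasDerivAt_of_le huv hcont hderiv
      ((intervalIntegrable_iff_integrableOn_Ioc_of_le huv).2 hint),
      intervalIntegral.integral_of_le huv, integral_Ioc_eq_integral_Ioo]
    refine ofReal_integral_eq_lintegral_ofReal (hint.mono_set Ioo_subset_Ioc_self) ?_
    exact (ae_restrict_iff' measurableSet_Ioo).2 (Eventually.of_forall hpos)
  have hφ : AEMeasurable (fun s => ENNReal.ofReal (φ s)) (volume.restrict (Ioo u v)) :=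
    (hint.mono_set Ioo_subset_Ioc_self).aestronglyMeasurable.aemeasurable.ennreal_ofReal
  have hkey : ENNReal.ofReal (Φ v - Φ u) * A ≤ ENNReal.ofReal (r / p) *
      ∫⁻ s in Ioo (0 : ℝ) t, g s ^ r * ENNReal.ofReal (s ^ (r / p - 1)) := by
    rw [hΦ, ← lintegral_mul_const'' _ hφ, ← lintegral_const_mul' _ _ ENNReal.ofReal_ne_top]
    exact (setLIntegral_mono' measurableSet_Ioo hle).trans
      (lintegral_mono_set (Ioo_subset_Ioo hu hvt))
  have ht' : ENNReal.ofReal t ^ (-(1 / p)) = ENNReal.ofReal (t ^ (-(r / p))) ^ (1 / r) := by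
    rw [← ENNReal.ofReal_rpow_of_pos ht, ← ENNReal.rpow_mul]
    congr 1
    field_simp
  rw [hardyUE, if_pos ht, ht', ← ENNReal.mul_rpow_of_nonneg _ _ (by positivity),
    ENNReal.ofReal_mul (by positivity), mul_assoc]
  gcongr

lemma le_hardyUE_of_antitone {p r a t : ℝ} (hp : 0 < p) (hr : 0 < r) (ha : 0 < a) (ha1 : a < 1)
    (ht : 0 < t) {g : ℝ → ℝ≥0∞} (hg : Antitone g) :
    (ENNReal.ofReal (a ^ (r / p)) * g (a * t) ^ r) ^ (1 / r) ≤ hardyUE p r g t := by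
  have hc : 0 < r / p := by positivity
  have hat : 0 < a * t := by positivity
  have h := le_hardyUE_of_hasDerivAt (p := p) (g := g) (A := g (a * t) ^ r)
    (Φ := fun s => s ^ (r / p)) (φ := fun s => r / p * s ^ (r / p - 1)) hr le_rfl
    hat.le (by nlinarith : a * t ≤ t) ht
    (Real.continuous_rpow_const hc.le).continuousOn
    (fun s hs => Real.hasDerivAt_rpow_const (Or.inl hs.1.ne'))
    (fun s hs => mul_nonneg hc.le (Real.rpow_nonneg hs.1.le _))
    (fun s hs => by
      rw [ENNReal.ofReal_mul hc.le, mul_assoc, mul_comm (ENNReal.ofReal (s ^ _))]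
      gcongr
      exact hg hs.2.le)
  convert h using 4
  rw [Real.zero_rpow hc.ne', sub_zero, Real.mul_rpow ha.le ht.le, Real.rpow_neg ht.le]
  field_simp

lemma le_hardyUE_iterate {p r : ℝ} (hp : 0 < p) (hr : 0 < r) {g : ℝ → ℝ≥0∞} (hg : Antitone g)
    (n : ℕ) : ∀ {a t : ℝ}, 0 < a → a < 1 → 0 < t →
    (ENNReal.ofReal (a ^ (r / p) * (r / p * Real.log (1 / a)) ^ n / n.factorial) *
      g (a * t) ^ r) ^ (1 / r) ≤ (hardyUE p r)^[n + 1] g t := by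
  have hc : 0 < r / p := by positivity
  induction n with
  | zero =>
    intro a t ha ha1 ht
    simpa using le_hardyUE_of_antitone hp hr ha ha1 ht hg
  | succ n ih =>
    intro a t ha ha1 ht
    have hat : 0 < a * t := by positivity
    rw [Function.iterate_succ_apply']
    have hlog : ∀ s ∈ Ioo (a * t) t, 0 ≤ Real.log (s / (a * t)) := fun s hs =>
      Real.log_nonneg ((one_le_div hat).2 hs.1.le)
    have h := le_hardyUE_of_hasDerivAt (p := p) (g := (hardyUE p r)^[n + 1] g)
      (A := g (a * t) ^ r)
      (Φ := fun s =>
        (a * t) ^ (r / p) * ((r / p * Real.log (s / (a * t))) ^ (n + 1) / (n + 1).factorial))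
      (φ := fun s =>
        (a * t) ^ (r / p) * ((r / p * Real.log (s / (a * t))) ^ n / n.factorial) * (r / p / s))
      hr hat.le (by nlinarith : a * t ≤ t) le_rfl ht
      (by
        refine continuousOn_const.mul (ContinuousOn.div_const (ContinuousOn.pow
          (continuousOn_const.mul (ContinuousOn.log (by fun_prop) ?_)) _) _)
        exact fun s hs => (div_pos (hat.trans_le hs.1) hat).ne')
      (fun s hs => by
        have hs0 : 0 < s := hat.trans hs.1
        have hd := ((((((hasDerivAt_id s).div_const (a * t)).log
          (div_pos hs0 hat).ne').const_mul (r / p)).pow (n + 1)).div_const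
          ((n + 1).factorial : ℝ)).const_mul ((a * t) ^ (r / p))
        refine hd.congr_deriv ?_
        simp only [id, Nat.factorial_succ, Nat.cast_mul, Nat.add_sub_cancel]
        have : ((n + 1 : ℕ) : ℝ) ≠ 0 := by positivity
        field_simp)
      (fun s hs => by
        have hs0 : 0 < s := hat.trans hs.1
        have := hlog s hs
        positivity)
      (fun s hs => by
        have hs0 : 0 < s := hat.trans hs.1
        have hl := hlog s hs
        have hI := ENNReal.rpow_le_rpow (ih (div_pos hat hs0) ((div_lt_one hs0).2 hs.1) hs0) hr.le
        rw [← ENNReal.rpow_mul, one_div_mul_cancel hr.ne', ENNReal.rpow_one,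
          div_mul_cancel₀ _ hs0.ne', one_div_div] at hI
        calc _ = ENNReal.ofReal (r / p) * (ENNReal.ofReal ((a * t / s) ^ (r / p) *
              (r / p * Real.log (s / (a * t))) ^ n / n.factorial) * g (a * t) ^ r *
              ENNReal.ofReal (s ^ (r / p - 1))) := by
              rw [mul_right_comm (ENNReal.ofReal _) (g (a * t) ^ r), ← mul_assoc,
                ← ENNReal.ofReal_mul (by positivity), ← ENNReal.ofReal_mul (by positivity)]
              congr 2
              rw [Real.div_rpow hat.le hs0.le, Real.rpow_sub_one hs0.ne']
              have := (Real.rpow_pos_of_pos hs0 (r / p)).ne'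
              field_simp
          _ ≤ _ := by gcongr)
    convert h using 4
    have h1 : t / (a * t) = 1 / a := by field_simp
    rw [div_self hat.ne', h1, Real.log_one, mul_zero, zero_pow n.succ_ne_zero, zero_div, mul_zero,
      sub_zero, Real.mul_rpow ha.le ht.le, Real.rpow_neg ht.le]
    have := (Real.rpow_pos_of_pos ht (r / p)).ne'
    field_simp

/-- Lower bound for the iterated Hardy operator:
`(H^{(p,r)})^{n+1} f (t) ≥ (a^{r/p} ((r/p) log(1/a))ⁿ / n!)^{1/r} f^*(a t)` for `0 < a < 1`. -/
theorem hardyU_iterate_lower_bound (p r : ℝ) (hp : 0 < p) (hr : 0 < r)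
    (f : ℝ → ℝ) (hf : Measurable f) (n : ℕ) (a t : ℝ)
    (ha : 0 < a) (ha1 : a < 1) (ht : 0 < t) :
    (ENNReal.ofReal (a ^ (r/p)) * ENNReal.ofReal ((r/p) * Real.log (1/a)) ^ n /
        (Nat.factorial n : ℝ≥0∞)) ^ (1/r) * rearr f (a * t) ≤
      (hardyUE p r)^[n] (hardyU p r f) t := by
  have h := le_hardyUE_iterate hp hr (antitone_distRearr volume fun x => ENNReal.ofReal |f x|) n
    ha ha1 ht
  have hlog : 0 ≤ Real.log (1 / a) := Real.log_nonneg (by rw [le_div_iff₀ ha]; linarith)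
  rw [Function.iterate_succ_apply] at h
  refine le_trans (le_of_eq ?_) h
  rw [ENNReal.mul_rpow_of_nonneg _ _ (by positivity), ← ENNReal.rpow_mul,
    mul_one_div_cancel hr.ne', ENNReal.rpow_one, ENNReal.ofReal_div_of_pos (by positivity),
    ENNReal.ofReal_mul (Real.rpow_nonneg ha.le _), ENNReal.ofReal_pow (by positivity),
    ENNReal.ofReal_natCast]
  rfl

end
end
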